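/- Let p be an odd prime and α, β, γ ∈ ℤ_p. Assume max{⟨−α⟩_p, ⟨−β⟩_p} ≤ ⟨−γ⟩_p, that (γ)_{p−1} ≢ 0 (mod p²), and that ⟨−α⟩_p + ⟨−β⟩_p > p. Then ∑_{k=0}^{p−1} (α)_k(β)_k(γ−α−β)_k/((k!)²(γ)_k) ≡ 0 (mod p²), i.e. the truncated series ₃F₂[α, β, γ−α−β; 1, γ | 1]_{p−1} has p-adic norm at most p^{−2}. (This is the vanishing case of the p-adic analogue of the Pfaff–Saalschütz theorem.) -/

import Mathlib

open scoped BigOperators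

/-- The Pochhammer symbol `(x)_k = x(x+1)⋯(x+k-1)` in `ℚ_[p]`. -/
noncomputable def poch (p : ℕ) [Fact p.Prime] (x : ℚ_[p]) (k : ℕ) : ℚ_[p] :=
  (ascPochhammer ℚ_[p] k).eval x

/-- The least non-negative residue `⟨α⟩_p ∈ {0,…,p-1}` of `α ∈ ℤ_[p]` modulo `p`. -/
noncomputable def res (p : ℕ) [Fact p.Prime] (α : ℤ_[p]) : ℕ :=
  (PadicInt.toZMod α).val

open Polynomial in
theorem ascPochhammer_eval_eq_prod {R : Type*} [CommRing R] (x : R) (n : ℕ) :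
    (ascPochhammer R n).eval x = ∏ i ∈ Finset.range n, (x + i) := by
  induction n with
  | zero => simp
  | succ n ih => rw [ascPochhammer_succ_eval, ih, Finset.prod_range_succ]

theorem ascPochhammer_eval_eq_mul_prod {R : Type*} [CommRing R] (x : R) {n k : ℕ} (h : k ≤ n) :
    (ascPochhammer R n).eval x =
      (ascPochhammer R k).eval x * ∏ i ∈ Finset.range (n - k), (x + n - (i + 1)) := by
  obtain ⟨m, rfl⟩ := Nat.exists_eq_add_of_le h
  rw [ascPochhammer_eval_eq_prod, ascPochhammer_eval_eq_prod, Finset.prod_range_add,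
    Nat.add_sub_cancel_left, ← Finset.prod_range_reflect (fun i => x + ((k + i : ℕ) : R))]
  congr 1
  refine Finset.prod_congr rfl fun i hi => ?_
  have hi : i + 1 ≤ m := Finset.mem_range.1 hi
  rw [show m - 1 - i = m - (i + 1) by omega]
  push_cast [Nat.cast_sub hi]
  ring

theorem factorial_mul_ascPochhammer_eval_neg {R : Type*} [CommRing R] {n k : ℕ} (h : k ≤ n) :
    (n.factorial : R) * (ascPochhammer R k).eval (-(n : R)) =
      (-1) ^ k * (n.choose k : R) ^ 2 * (n - k).factorial * (k.factorial : R) ^ 2 := by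
  rw [ascPochhammer_eval_neg_eq_descPochhammer, descPochhammer_eval_eq_descFactorial,
    Nat.descFactorial_eq_factorial_mul_choose, ← Nat.choose_mul_factorial_mul_factorial h]
  push_cast
  ring

theorem choose_succ_sq_mul_factorial {n k : ℕ} (h : k ≤ n) :
    (n + 1).choose (k + 1) ^ 2 * (n - k).factorial =
      n.choose k ^ 2 * (n - k).factorial
        + (n + 2 + k) * (n.choose (k + 1) ^ 2 * (n - (k + 1)).factorial) := by
  obtain rfl | hlt := h.eq_or_lt
  · simp
  obtain ⟨m, rfl⟩ := Nat.exists_eq_add_of_le hlt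
  have hsymm := Nat.choose_succ_right_eq (k + 1 + m) k
  rw [show k + 1 + m - k = m + 1 by omega] at *
  rw [Nat.choose_succ_succ, Nat.add_sub_cancel_left, Nat.factorial_succ]
  zify at *
  linear_combination -2 * ((k + 1 + m).choose (k + 1) : ℤ) * (m.factorial : ℤ) * hsymm

/-- The Pfaff–Saalschütz identity, with denominators cleared. -/
theorem pfaff_saalschutz {R : Type*} [CommRing R] (x y : R) (n : ℕ) :
    ∑ k ∈ Finset.range (n + 1), (-1) ^ k * ((n.choose k ^ 2 * (n - k).factorial : ℕ) : R)
        * ((ascPochhammer R k).eval x * (ascPochhammer R k).eval y)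
        * ∏ i ∈ Finset.range (n - k), (x + y - (i + 1))
      = (-1) ^ n * ∏ i ∈ Finset.range n, ((x - (i + 1)) * (y - (i + 1))) := by
  induction n with
  | zero => simp
  | succ n ih =>
    rw [Finset.prod_range_succ, pow_succ]
    trans -((x - (n + 1)) * (y - (n + 1))) *
      ((-1) ^ n * ∏ i ∈ Finset.range n, ((x - (i + 1)) * (y - (i + 1))))
    swap
    · ring
    rw [← ih, Finset.mul_sum]
    let h : ℕ → R := fun k => (-1) ^ k * (n + 1 + k) *
      ((n.choose k ^ 2 * (n - k).factorial : ℕ) : R)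
        * ((ascPochhammer R k).eval x * (ascPochhammer R k).eval y)
        * ∏ i ∈ Finset.range (n + 1 - k), (x + y - (i + 1))
    have hshift : ∑ k ∈ Finset.range (n + 1), h k = ∑ k ∈ Finset.range (n + 1), h (k + 1) + h 0 := by
      rw [← Finset.sum_range_succ', Finset.sum_range_succ h (n + 1)]
      simp [h]
    have hsplit : ∀ k ∈ Finset.range (n + 1),
        -((x - (n + 1)) * (y - (n + 1))) *
          ((-1) ^ k * ((n.choose k ^ 2 * (n - k).factorial : ℕ) : R)
          * ((ascPochhammer R k).eval x * (ascPochhammer R k).eval y)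
          * ∏ i ∈ Finset.range (n - k), (x + y - (i + 1)))
        = h k + (-1) ^ (k + 1) * ((n.choose k ^ 2 * (n - k).factorial : ℕ) : R)
          * ((ascPochhammer R (k + 1)).eval x * (ascPochhammer R (k + 1)).eval y)
          * ∏ i ∈ Finset.range (n - k), (x + y - (i + 1)) := by
      intro k hk
      have hk : k ≤ n := Nat.lt_succ_iff.1 (Finset.mem_range.1 hk)
      simp only [h]
      rw [Nat.succ_sub hk, Finset.prod_range_succ, ascPochhammer_succ_eval,
        ascPochhammer_succ_eval, Nat.cast_sub hk]
      ring
    rw [Finset.sum_congr rfl hsplit, Finset.sum_add_distrib, hshift, Finset.sum_range_succ',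
      add_right_comm, ← Finset.sum_add_distrib]
    congr 1
    · refine Finset.sum_congr rfl fun k hk => ?_
      have hk : k ≤ n := Nat.lt_succ_iff.1 (Finset.mem_range.1 hk)
      simp only [h, Nat.add_sub_add_right]
      rw [choose_succ_sq_mul_factorial hk]
      push_cast
      ring
    · simp [h, Nat.factorial_succ]

theorem factorial_mul_sum_saalschutz {R : Type*} [CommRing R] (x γ : R) (u : ℕ → R) {n N : ℕ}
    (hn : n ≤ N)
    (hu : ∀ k ≤ N, u k * ((k.factorial : R) ^ 2 * (ascPochhammer R k).eval γ) = 1) :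
    n.factorial * (ascPochhammer R n).eval γ * ∑ k ∈ Finset.range (N + 1),
        u k * ((ascPochhammer R k).eval (-(n : R)) * (ascPochhammer R k).eval x
          * (ascPochhammer R k).eval (γ + n - x))
      = (-1) ^ n * ∏ i ∈ Finset.range n, ((x - (i + 1)) * (γ + n - x - (i + 1))) := by
  rw [← pfaff_saalschutz, Finset.mul_sum]
  symm
  refine Finset.sum_subset_zero_on_sdiff (Finset.range_mono (by omega)) ?_ ?_
  · intro k hk
    have hk : n < k := by simp at hk; omega
    rw [ascPochhammer_eval_neg_coe_nat_of_lt hk]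
    ring
  · intro k hk
    have hk : k ≤ n := Nat.lt_succ_iff.1 (Finset.mem_range.1 hk)
    rw [ascPochhammer_eval_eq_mul_prod γ hk, add_sub_cancel]
    have h1 := factorial_mul_ascPochhammer_eval_neg (R := R) hk
    have h2 := hu k (hk.trans hn)
    push_cast
    generalize ∏ i ∈ Finset.range (n - k), (γ + n - ((i : R) + 1)) = f
    generalize (ascPochhammer R k).eval x = X at *
    generalize (ascPochhammer R k).eval (γ + n - x) = Y at *
    generalize (ascPochhammer R k).eval γ = G at *
    generalize (ascPochhammer R k).eval (-(n : R)) = A at *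
    linear_combination (-u k * G * f * X * Y) * h1 -
      ((-1) ^ k * (n.choose k : R) ^ 2 * (n - k).factorial * X * Y * f) * h2

open Polynomial in
theorem mul_sub_dvd_evalEval {R : Type*} [CommRing R] (P : R[X][X]) (x x' y y' : R) :
    (x - x') * (y - y') ∣
      P.evalEval x y - P.evalEval x y' - (P.evalEval x' y - P.evalEval x' y') := by
  obtain ⟨Q, hQ⟩ := sub_dvd_eval_sub (C y) (C y') P
  obtain ⟨r, hr⟩ := sub_dvd_eval_sub x x' Q
  have hx := congrArg (eval x) hQ
  have hx' := congrArg (eval x') hQ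
  simp only [eval_sub, eval_mul, eval_C] at hx hx'
  refine ⟨r, ?_⟩
  simp only [evalEval]
  linear_combination hx - hx' + (y - y') * hr

open Polynomial in
theorem map_ascPochhammer_eval {R S : Type*} [CommRing R] [CommRing S] (f : R →+* S) (k : ℕ)
    (x : R) : f ((ascPochhammer R k).eval x) = (ascPochhammer S k).eval (f x) := by
  rw [ascPochhammer_eval_eq_prod, ascPochhammer_eval_eq_prod]
  simp

open Polynomial in
theorem mul_sub_dvd_sum_ascPochhammer {R : Type*} [CommRing R] (γ x x' y y' : R) (u : ℕ → R)
    (s : Finset ℕ) (F : R → R → R)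
    (hF : ∀ x y, F x y = ∑ k ∈ s, u k * ((ascPochhammer R k).eval x * (ascPochhammer R k).eval y
      * (ascPochhammer R k).eval (γ - x - y))) :
    (x - x') * (y - y') ∣ F x y - F x y' - (F x' y - F x' y') := by
  let P : R[X][X] := ∑ k ∈ s, C (C (u k)) * ((ascPochhammer R[X][X] k).eval (C X)
    * (ascPochhammer R[X][X] k).eval X * (ascPochhammer R[X][X] k).eval (C (C γ) - C X - X))
  have hP : ∀ x y, F x y = P.evalEval x y := by
    intro x y
    rw [← coe_evalEvalRingHom, hF]
    simp only [P, map_sum, map_mul, map_ascPochhammer_eval, map_sub]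
    simp
  simp only [hP]
  exact mul_sub_dvd_evalEval P x x' y y'

theorem padicInt_dvd_add_res (p : ℕ) [Fact p.Prime] (x : ℤ_[p]) :
    (p : ℤ_[p]) ∣ x + (PadicInt.toZMod (-x)).val := by
  rw [← Ideal.mem_span_singleton, ← PadicInt.maximalIdeal_eq_span_p, ← PadicInt.ker_toZMod,
    RingHom.mem_ker]
  simp

theorem padicInt_dvd_natCast_iff (p : ℕ) [Fact p.Prime] (n : ℕ) :
    (p : ℤ_[p]) ∣ n ↔ p ∣ n := by
  rw [← Ideal.mem_span_singleton, ← PadicInt.maximalIdeal_eq_span_p, ← PadicInt.ker_toZMod,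
    RingHom.mem_ker, map_natCast, ZMod.natCast_eq_zero_iff]

theorem padicInt_isUnit_iff_not_dvd (p : ℕ) [Fact p.Prime] (x : ℤ_[p]) :
    IsUnit x ↔ ¬ (p : ℤ_[p]) ∣ x := by
  rw [← Ideal.mem_span_singleton, ← PadicInt.maximalIdeal_eq_span_p, IsLocalRing.mem_maximalIdeal,
    mem_nonunits_iff, not_not]

theorem natCast_dvd_ascPochhammer_eval {R : Type*} [CommRing R] {q x : R} {n k : ℕ}
    (hx : q ∣ x + n) (h : n < k) : q ∣ (ascPochhammer R k).eval x := by
  rw [ascPochhammer_eval_eq_prod]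
  exact hx.trans (Finset.dvd_prod_of_mem _ (Finset.mem_range.2 h))

theorem isUnit_factorial_sq_mul_ascPochhammer (p : ℕ) [Fact p.Prime] {γ : ℤ_[p]} {c k : ℕ}
    (hc : c < p) (hγ : (p : ℤ_[p]) ∣ γ + c) (hk : k ≤ c) :
    IsUnit ((k.factorial : ℤ_[p]) ^ 2 * (ascPochhammer ℤ_[p] k).eval γ) := by
  have hp : Prime (p : ℤ_[p]) := PadicInt.prime_p
  rw [padicInt_isUnit_iff_not_dvd, hp.dvd_mul, not_or]
  constructor
  · intro h
    have := (padicInt_dvd_natCast_iff p _).1 (hp.dvd_of_dvd_pow h)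
    have := ((Fact.out : p.Prime).dvd_factorial).1 this
    omega
  · rw [ascPochhammer_eval_eq_prod, hp.dvd_finsetProd_iff]
    rintro ⟨j, hj, hdvd⟩
    have hj : j < k := Finset.mem_range.1 hj
    have h := dvd_sub hγ hdvd
    rw [add_sub_add_left_eq_sub, ← Nat.cast_sub (by omega), padicInt_dvd_natCast_iff] at h
    have := Nat.le_of_dvd (by omega) h
    omega

theorem sq_dvd_sum_of_neg_natCast (p : ℕ) [Fact p.Prime] {γ x : ℤ_[p]} {u : ℕ → ℤ_[p]} {a b c : ℕ}
    (hc : c < p) (ha : a ≤ c) (hb : b ≤ c) (hab : p < a + b)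
    (hu : ∀ k ≤ c, u k * ((k.factorial : ℤ_[p]) ^ 2 * (ascPochhammer ℤ_[p] k).eval γ) = 1)
    (hγ : (p : ℤ_[p]) ∣ γ + c) (hx : (p : ℤ_[p]) ∣ x + b) :
    (p : ℤ_[p]) ^ 2 ∣ ∑ k ∈ Finset.range (c + 1),
        u k * ((ascPochhammer ℤ_[p] k).eval (-(a : ℤ_[p])) * (ascPochhammer ℤ_[p] k).eval x
          * (ascPochhammer ℤ_[p] k).eval (γ + a - x)) := by
  have hunit : IsUnit ((a.factorial : ℤ_[p]) * (ascPochhammer ℤ_[p] a).eval γ) :=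
    IsUnit.of_mul_eq_one (u a * a.factorial) (by linear_combination hu a ha)
  rw [← hunit.dvd_mul_left, factorial_mul_sum_saalschutz x γ u ha hu, Finset.prod_mul_distrib, sq]
  refine Dvd.dvd.mul_left (mul_dvd_mul ?_ ?_) _
  · refine dvd_trans ?_ (Finset.dvd_prod_of_mem _ (Finset.mem_range.2 (show p - b - 1 < a by omega)))
    have h : ((p - b - 1 : ℕ) : ℤ_[p]) + 1 = p - b := by
      rw [← Nat.cast_sub (by omega), ← Nat.cast_succ]
      congr 1
      omega
    rw [h, ← sub_add, sub_add_eq_add_sub]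
    exact dvd_sub_self_right.2 hx
  · refine dvd_trans ?_
      (Finset.dvd_prod_of_mem _ (Finset.mem_range.2 (show a + b - c - 1 < a by omega)))
    have h : ((a + b - c - 1 : ℕ) : ℤ_[p]) + 1 = a + b - c := by
      rw [← Nat.cast_add, ← Nat.cast_sub (by omega), ← Nat.cast_succ]
      congr 1
      omega
    rw [h]
    convert dvd_sub hγ hx using 1
    ring

/-- The part of the series whose denominators are `p`-adic units is divisible by `p ^ 2`. -/
theorem sq_dvd_sum_range_succ (p : ℕ) [Fact p.Prime] {α β γ : ℤ_[p]} {u : ℕ → ℤ_[p]} {a b c : ℕ}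
    (hc : c < p) (ha : a ≤ c) (hb : b ≤ c) (hab : p < a + b)
    (hu : ∀ k ≤ c, u k * ((k.factorial : ℤ_[p]) ^ 2 * (ascPochhammer ℤ_[p] k).eval γ) = 1)
    (hα : (p : ℤ_[p]) ∣ α + a) (hβ : (p : ℤ_[p]) ∣ β + b) (hγ : (p : ℤ_[p]) ∣ γ + c) :
    (p : ℤ_[p]) ^ 2 ∣ ∑ k ∈ Finset.range (c + 1),
        u k * ((ascPochhammer ℤ_[p] k).eval α * (ascPochhammer ℤ_[p] k).eval β
          * (ascPochhammer ℤ_[p] k).eval (γ - α - β)) := by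
  let F : ℤ_[p] → ℤ_[p] → ℤ_[p] := fun x y => ∑ k ∈ Finset.range (c + 1),
    u k * ((ascPochhammer ℤ_[p] k).eval x * (ascPochhammer ℤ_[p] k).eval y
      * (ascPochhammer ℤ_[p] k).eval (γ - x - y))
  have hleft : ∀ y, (p : ℤ_[p]) ∣ y + b → (p : ℤ_[p]) ^ 2 ∣ F (-a) y := fun y hy => by
    simpa only [F, sub_neg_eq_add] using sq_dvd_sum_of_neg_natCast p hc ha hb hab hu hγ hy
  have hright : (p : ℤ_[p]) ^ 2 ∣ F α (-b) := by
    convert sq_dvd_sum_of_neg_natCast p hc hb ha (by omega) hu hγ hα using 1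
    refine Finset.sum_congr rfl fun k _ => ?_
    rw [show γ - α - -(b : ℤ_[p]) = γ + b - α by ring]
    ring
  have hmixed := (mul_dvd_mul hα hβ).trans (by
    simpa only [sub_neg_eq_add] using
      mul_sub_dvd_sum_ascPochhammer γ α (-a) β (-b) u _ F fun _ _ => rfl)
  rw [← sq] at hmixed
  have h := dvd_add (dvd_add hmixed hright) (dvd_sub (hleft β hβ) (hleft (-b) (by simp)))
  convert h using 1
  ring

theorem poch_coe (p : ℕ) [Fact p.Prime] (x : ℤ_[p]) (k : ℕ) :
    poch p (x : ℚ_[p]) k = ((ascPochhammer ℤ_[p] k).eval x : ℤ_[p]) :=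
  (map_ascPochhammer_eval PadicInt.Coe.ringHom k x).symm

theorem padicInt_norm_le_zpow_iff_dvd (p : ℕ) [Fact p.Prime] (x : ℤ_[p]) (n : ℕ) :
    ‖(x : ℚ_[p])‖ ≤ (p : ℝ) ^ (-n : ℤ) ↔ (p : ℤ_[p]) ^ n ∣ x := by
  rw [← PadicInt.norm_def, PadicInt.norm_le_pow_iff_mem_span_pow, Ideal.mem_span_singleton]

theorem norm_div_le_of_pow_three_dvd (p : ℕ) [Fact p.Prime] {x d : ℤ_[p]}
    (hx : (p : ℤ_[p]) ^ 3 ∣ x) (hd : ¬ (p : ℤ_[p]) ^ 2 ∣ d) :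
    ‖(x : ℚ_[p]) / d‖ ≤ (p : ℝ) ^ (-2 : ℤ) := by
  have hp : (0 : ℝ) < p := mod_cast (Fact.out : p.Prime).pos
  have h1 := (padicInt_norm_le_zpow_iff_dvd p x 3).2 hx
  have h2 : (p : ℝ) ^ (-1 : ℤ) ≤ ‖(d : ℚ_[p])‖ := by
    by_contra h
    refine hd ((padicInt_norm_le_zpow_iff_dvd p d 2).1 ?_)
    rw [Padic.norm_le_pow_iff_norm_lt_pow_add_one]
    simpa using h
  have h0 : (0 : ℝ) < (p : ℝ) ^ (-1 : ℤ) := zpow_pos hp _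
  rw [norm_div, div_le_iff₀ (h0.trans_le h2)]
  calc _ ≤ (p : ℝ) ^ (-(3 : ℕ) : ℤ) := h1
    _ = (p : ℝ) ^ (-2 : ℤ) * (p : ℝ) ^ (-1 : ℤ) := by rw [← zpow_add₀ hp.ne']; norm_num
    _ ≤ _ := by gcongr

/-- Vanishing case of the p-adic analogue of the Pfaff–Saalschütz theorem:
`₃F₂[α,β,γ−α−β;1,γ|1]_{p−1} ≡ 0 (mod p²)` when `⟨−α⟩_p + ⟨−β⟩_p > p`. -/
theorem padic_pfaff_saalschutz_vanishing
    (p : ℕ) [Fact p.Prime] (hp : Odd p) (α β γ : ℤ_[p])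
    (h1 : res p (-α) ≤ res p (-γ)) (h2 : res p (-β) ≤ res p (-γ))
    (hpoch : ¬ ((p : ℤ_[p]) ^ 2 ∣ (ascPochhammer ℤ_[p] (p - 1)).eval γ))
    (h3 : res p (-α) + res p (-β) > p) :
    ‖∑ k ∈ Finset.range p,
        poch p (α : ℚ_[p]) k * poch p (β : ℚ_[p]) k
          * poch p ((γ : ℚ_[p]) - (α : ℚ_[p]) - (β : ℚ_[p])) k
          / ((Nat.factorial k : ℚ_[p]) ^ 2 * poch p (γ : ℚ_[p]) k)‖
      ≤ (p : ℝ) ^ (-2 : ℤ) := by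
  have hc : res p (-γ) < p := ZMod.val_lt _
  have hα := padicInt_dvd_add_res p α
  have hβ := padicInt_dvd_add_res p β
  have hγ := padicInt_dvd_add_res p γ
  simp only [← res.eq_1] at hα hβ hγ
  generalize res p (-α) = a at *
  generalize res p (-β) = b at *
  generalize res p (-γ) = c at *
  have hunit : ∀ k ≤ c, IsUnit ((k.factorial : ℤ_[p]) ^ 2 * (ascPochhammer ℤ_[p] k).eval γ) :=
    fun k hk => isUnit_factorial_sq_mul_ascPochhammer p hc hγ hk
  let u : ℕ → ℤ_[p] := fun k =>
    Ring.inverse ((k.factorial : ℤ_[p]) ^ 2 * (ascPochhammer ℤ_[p] k).eval γ)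
  have hu : ∀ k ≤ c, u k * ((k.factorial : ℤ_[p]) ^ 2 * (ascPochhammer ℤ_[p] k).eval γ) = 1 :=
    fun k hk => Ring.inverse_mul_cancel _ (hunit k hk)
  have hterm : ∀ k, poch p (α : ℚ_[p]) k * poch p (β : ℚ_[p]) k
      * poch p ((γ : ℚ_[p]) - (α : ℚ_[p]) - (β : ℚ_[p])) k
      / ((Nat.factorial k : ℚ_[p]) ^ 2 * poch p (γ : ℚ_[p]) k)
      = (((ascPochhammer ℤ_[p] k).eval α * (ascPochhammer ℤ_[p] k).eval β
        * (ascPochhammer ℤ_[p] k).eval (γ - α - β) : ℤ_[p]) : ℚ_[p])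
        / (((k.factorial : ℤ_[p]) ^ 2 * (ascPochhammer ℤ_[p] k).eval γ : ℤ_[p]) : ℚ_[p]) := by
    intro k
    rw [← PadicInt.coe_sub, ← PadicInt.coe_sub]
    simp only [poch_coe]
    push_cast
    rfl
  simp only [hterm]
  rw [← Finset.sum_range_add_sum_Ico _ (show c + 1 ≤ p from hc)]
  refine (IsUltrametricDist.norm_add_le_max _ _).trans (max_le ?_ ?_)
  · refine le_of_eq_of_le (congrArg norm ?_) ((padicInt_norm_le_zpow_iff_dvd p _ 2).2
      (sq_dvd_sum_range_succ p hc h1 h2 h3 hu hα hβ hγ))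
    rw [PadicInt.coe_sum]
    refine Finset.sum_congr rfl fun k hk => ?_
    have hk : k ≤ c := Nat.lt_succ_iff.1 (Finset.mem_range.1 hk)
    have h := congrArg (fun x : ℤ_[p] => (x : ℚ_[p])) (hu k hk)
    simp only [PadicInt.coe_mul (u k), PadicInt.coe_one] at h
    rw [div_eq_iff (right_ne_zero_of_mul_eq_one h), PadicInt.coe_mul (u k)]
    linear_combination (-(((ascPochhammer ℤ_[p] k).eval α * (ascPochhammer ℤ_[p] k).eval β
        * (ascPochhammer ℤ_[p] k).eval (γ - α - β) : ℤ_[p]) : ℚ_[p])) * h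
  · refine IsUltrametricDist.norm_sum_le_of_forall_le_of_nonneg (by positivity) fun k hk => ?_
    obtain ⟨hck, hkp⟩ := Finset.mem_Ico.1 hk
    refine norm_div_le_of_pow_three_dvd p ?_ ?_
    · rw [pow_succ, sq]
      have hδ : (p : ℤ_[p]) ∣ γ - α - β + (p + c - a - b : ℕ) := by
        rw [Nat.sub_sub, Nat.cast_sub (by omega)]
        push_cast
        convert dvd_add (dvd_sub hγ (dvd_add hα hβ)) (dvd_refl (p : ℤ_[p])) using 1
        ring
      exact mul_dvd_mul (mul_dvd_mul (natCast_dvd_ascPochhammer_eval hα (by omega))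
        (natCast_dvd_ascPochhammer_eval hβ (by omega)))
        (natCast_dvd_ascPochhammer_eval hδ (by omega))
    · have hfac : IsUnit ((k.factorial : ℤ_[p]) ^ 2) := by
        rw [isUnit_pow_iff two_ne_zero, padicInt_isUnit_iff_not_dvd, padicInt_dvd_natCast_iff,
          (Fact.out : p.Prime).dvd_factorial]
        omega
      rw [hfac.dvd_mul_left]
      refine fun h => hpoch (h.trans ?_)
      rw [ascPochhammer_eval_eq_mul_prod γ (show k ≤ p - 1 by omega)]
      exact dvd_mul_right _ _
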